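/- Let α > 0, let ν be a symmetric probability measure on ℝ with ν({0}) = 0, and let K(x,·) := δ̃_x ▵_α ν. For every k ≥ 1, ∫_{(−∞,0]} ⋯ ∫_{(−∞,0]} K(x_{k−1}, (0,∞)) K(x_{k−2}, dx_{k−1}) ⋯ K(x₁, dx₂) ν(dx₁) = 2^{−k} (for k = 1 this reads ν((0,∞)) = 1/2). Equivalently, the first hitting time τ₀⁺ of (0,∞) by the Kendall random walk started at 0 satisfies P(τ₀⁺ = k) = 2^{−k} for k = 1, 2, …, i.e. τ₀⁺ has geometric distribution with parameter 1/2. -/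

import Mathlib

open MeasureTheory

/-- `Ψ(t) = (1 - |t|^α)₊`. -/
noncomputable def Psi (α t : ℝ) : ℝ := max (1 - |t| ^ α) 0

/-- The Williamson transform of a measure on `ℝ`. -/
noncomputable def williamson (α : ℝ) (ν : Measure ℝ) (t : ℝ) : ℝ :=
  ∫ x, Psi α (x * t) ∂ν

/-- A measure on `ℝ` is symmetric if it is invariant under `x ↦ -x`. -/
def IsSymmetric (ν : Measure ℝ) : Prop := ν.map (fun x => -x) = ν

/-- The rescaling operator `T_a`: `(T_a λ)(A) = λ(A / a)` for `a ≠ 0`, `T_0 λ = δ_0`. -/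
noncomputable def rescale (a : ℝ) (μ : Measure ℝ) : Measure ℝ :=
  if a = 0 then Measure.dirac 0 else μ.map (fun x => a * x)

/-- `δ̃_x = (δ_x + δ_{-x})/2`. -/
noncomputable def deltaTilde (x : ℝ) : Measure ℝ :=
  (2 : ENNReal)⁻¹ • (Measure.dirac x + Measure.dirac (-x))

/-- The symmetric Pareto measure `π̃_{2α}` with density `α |y|^{-2α-1} 1_{|y| ≥ 1}`. -/
noncomputable def pareto (α : ℝ) : Measure ℝ :=
  volume.withDensity fun y =>
    ENNReal.ofReal (if 1 ≤ |y| then α * |y| ^ (-2 * α - 1) else 0)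

/-- Kendall convolution of two symmetric two-point masses:
`δ̃_x ▵_α δ̃_y = T_M (ϱ^α π̃_{2α} + (1 - ϱ^α) δ̃_1)`. -/
noncomputable def kendallPoint (α x y : ℝ) : Measure ℝ :=
  let M := max |x| |y|
  let m := min |x| |y|
  let ρ := if M = 0 then 0 else m / M
  rescale M (ENNReal.ofReal (ρ ^ α) • pareto α +
    ENNReal.ofReal (1 - ρ ^ α) • deltaTilde 1)

/-- Kendall convolution of two measures on `ℝ`:
`(ν₁ ▵_α ν₂)(A) = ∫∫ (δ̃_x ▵_α δ̃_y)(A) ν₁(dx) ν₂(dy)`. -/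
noncomputable def kendall (α : ℝ) (ν₁ ν₂ : Measure ℝ) : Measure ℝ :=
  ν₁.bind fun x => ν₂.bind fun y => kendallPoint α x y

/-- `n`-fold Kendall convolution power `ν^{▵_α n}`. -/
noncomputable def kendallPow (α : ℝ) (ν : Measure ℝ) : ℕ → Measure ℝ
  | 0 => Measure.dirac 0
  | 1 => ν
  | n + 2 => kendall α (kendallPow α ν (n + 1)) ν

/-- The one-step kernel of the Kendall random walk: `K(x, ·) = δ̃_x ▵_α ν`. -/
noncomputable def kendallKernel (α : ℝ) (ν : Measure ℝ) (x : ℝ) : Measure ℝ :=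
  ν.bind fun y => kendallPoint α x y

/-- `excursion α ν n` is the sub-probability distribution of `X_{n+1}` on the event
`X₁ ≤ 0, …, X_n ≤ 0` for the Kendall random walk started at `0`, so that
`Φ_{n+1}(t) = excursion α ν n ((0,t))`. -/
noncomputable def excursion (α : ℝ) (ν : Measure ℝ) : ℕ → Measure ℝ
  | 0 => ν
  | n + 1 => ((excursion α ν n).restrict (Set.Iic 0)).bind (kendallKernel α ν)

lemma pareto_Ioi (α : ℝ) (hα : 0 < α) : pareto α (Set.Ioi 0) = 2⁻¹ := by
  unfold pareto
  rw [withDensity_apply _ measurableSet_Ioi]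
  have h1 : ∫⁻ y in Set.Ioi (0:ℝ), ENNReal.ofReal (if 1 ≤ |y| then α * |y| ^ (-2 * α - 1) else 0)
      = ∫⁻ y in Set.Ioi (0:ℝ), (Set.Ici (1:ℝ)).indicator
          (fun y => ENNReal.ofReal (α * y ^ (-2 * α - 1))) y := by
    apply setLIntegral_congr_fun measurableSet_Ioi
    intro y hy
    have hy' : (0:ℝ) < y := hy
    simp only [abs_of_pos hy', Set.indicator, Set.mem_Ici]
    split_ifs <;> simp
  rw [h1, lintegral_indicator measurableSet_Ici, Measure.restrict_restrict measurableSet_Ici]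
  have h2 : Set.Ici (1:ℝ) ∩ Set.Ioi 0 = Set.Ici 1 := by
    ext x; simp; intro h; linarith
  rw [h2, setLIntegral_congr (Ioi_ae_eq_Ici (a := (1:ℝ)) (μ := volume)).symm]
  have hlt : -2 * α - 1 < -1 := by linarith
  have hint := (integrableOn_Ioi_rpow_of_lt hlt (zero_lt_one)).const_mul α
  rw [← ofReal_integral_eq_lintegral_ofReal hint]
  · rw [integral_const_mul, integral_Ioi_rpow_of_lt hlt zero_lt_one]
    rw [show α * (-1 ^ (-2 * α - 1 + 1) / (-2 * α - 1 + 1)) = (2:ℝ)⁻¹ by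
      rw [Real.one_rpow]; field_simp; ring]
    rw [ENNReal.ofReal_inv_of_pos (by norm_num)]; simp
  · filter_upwards [ae_restrict_mem measurableSet_Ioi] with x hx
    have : (0:ℝ) < x := lt_trans zero_lt_one hx
    show 0 ≤ α * x ^ (-2 * α - 1)
    positivity

lemma pareto_Iic (α : ℝ) (hα : 0 < α) : pareto α (Set.Iic 0) = 2⁻¹ := by
  rw [← pareto_Ioi α hα]
  unfold pareto
  rw [withDensity_apply _ measurableSet_Ioi, withDensity_apply _ measurableSet_Iic,
    setLIntegral_congr (Iio_ae_eq_Iic (a := (0:ℝ)) (μ := volume)).symm]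
  have := (Measure.measurePreserving_neg (volume : Measure ℝ)).setLIntegral_comp_preimage_emb
    (MeasurableEquiv.neg ℝ).measurableEmbedding
    (fun y => ENNReal.ofReal (if 1 ≤ |y| then α * |y| ^ (-2 * α - 1) else 0)) (Set.Iio 0)
  rw [← this]
  simp

lemma kendallPoint_half (α : ℝ) (hα : 0 < α) (x y : ℝ) (hy : y ≠ 0) (s : Set ℝ)
    (hs : MeasurableSet s) (hinv : ∀ M : ℝ, 0 < M → (fun x => M * x) ⁻¹' s = s)
    (hp : pareto α s = 2⁻¹) (hd : deltaTilde 1 s = 2⁻¹) :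
    kendallPoint α x y s = 2⁻¹ := by
  have hM : 0 < max |x| |y| := lt_max_of_lt_right (abs_pos.2 hy)
  have h0 : 0 ≤ min |x| |y| / max |x| |y| := by positivity
  have h1 : min |x| |y| / max |x| |y| ≤ 1 := (div_le_one hM).2 min_le_max
  simp only [kendallPoint, rescale, if_neg hM.ne']
  rw [Measure.map_apply (by fun_prop) hs, hinv _ hM]
  simp only [Measure.add_apply, Measure.smul_apply, smul_eq_mul, hp, hd]
  rw [← add_mul, ← ENNReal.ofReal_add (by positivity)
    (sub_nonneg.2 (Real.rpow_le_one h0 h1 hα.le))]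
  simp

lemma deltaTilde_Ioi : deltaTilde 1 (Set.Ioi 0) = 2⁻¹ := by
  simp [deltaTilde]

lemma deltaTilde_Iic : deltaTilde 1 (Set.Iic 0) = 2⁻¹ := by
  simp [deltaTilde]

lemma inv_Ioi (M : ℝ) (hM : 0 < M) : (fun x => M * x) ⁻¹' (Set.Ioi (0:ℝ)) = Set.Ioi 0 := by
  ext x; simp [hM]

lemma inv_Iic (M : ℝ) (hM : 0 < M) : (fun x => M * x) ⁻¹' (Set.Iic (0:ℝ)) = Set.Iic 0 := by
  ext x
  simp only [Set.mem_preimage, Set.mem_Iic]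
  exact mul_nonpos_iff_pos_imp_nonpos.trans ⟨fun h => h.1 hM, fun h => ⟨fun _ => h, fun _ => hM.le⟩⟩

lemma measurable_rescale_aux (μ : Measure ℝ) [SFinite μ] (s : Set ℝ) (hs : MeasurableSet s) :
    Measurable fun a : ℝ => μ ((fun x => a * x) ⁻¹' s) := by
  have : MeasurableSet ((fun p : ℝ × ℝ => p.1 * p.2) ⁻¹' s) :=
    (measurable_fst.mul measurable_snd) hs
  exact measurable_measure_prodMk_left this

lemma measurable_kendallPoint (α : ℝ) :
    Measurable fun p : ℝ × ℝ => kendallPoint α p.1 p.2 := by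
  apply Measure.measurable_of_measurable_coe
  intro s hs
  have hM : Measurable fun p : ℝ × ℝ => max |p.1| |p.2| := by fun_prop
  have hm : Measurable fun p : ℝ × ℝ => min |p.1| |p.2| := by fun_prop
  have hM0 : MeasurableSet {p : ℝ × ℝ | max |p.1| |p.2| = 0} := hM (measurableSet_singleton 0)
  have hρ : Measurable fun p : ℝ × ℝ =>
      ((if max |p.1| |p.2| = 0 then 0 else min |p.1| |p.2| / max |p.1| |p.2|) ^ α : ℝ) :=
    (Measurable.ite hM0 measurable_const (hm.div hM)).pow_const α
  haveI : SFinite (pareto α) := by unfold pareto; infer_instance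
  haveI : SFinite (deltaTilde 1) := by unfold deltaTilde; infer_instance
  have hP := (measurable_rescale_aux (pareto α) s hs).comp hM
  have hD := (measurable_rescale_aux (deltaTilde 1) s hs).comp hM
  have : (fun p : ℝ × ℝ => kendallPoint α p.1 p.2 s) = fun p : ℝ × ℝ =>
      if max |p.1| |p.2| = 0 then Measure.dirac (0:ℝ) s else
        ENNReal.ofReal ((if max |p.1| |p.2| = 0 then 0 else min |p.1| |p.2| / max |p.1| |p.2|) ^ α)
          * pareto α ((fun x => max |p.1| |p.2| * x) ⁻¹' s) +
        ENNReal.ofReal (1 - (if max |p.1| |p.2| = 0 then 0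
          else min |p.1| |p.2| / max |p.1| |p.2|) ^ α)
          * deltaTilde 1 ((fun x => max |p.1| |p.2| * x) ⁻¹' s) := by
    funext p
    by_cases h : max |p.1| |p.2| = 0
    · simp only [kendallPoint, rescale, if_pos h]
    · simp only [kendallPoint, rescale, if_neg h]
      rw [Measure.map_apply (by fun_prop) hs]
      simp only [Measure.add_apply, Measure.smul_apply, smul_eq_mul]
  rw [this]
  exact Measurable.ite hM0 measurable_const
    ((hρ.ennreal_ofReal.mul hP).add ((measurable_const.sub hρ).ennreal_ofReal.mul hD))

lemma measurable_kendallPoint_right (α x : ℝ) : Measurable fun y => kendallPoint α x y :=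
  (measurable_kendallPoint α).comp measurable_prodMk_left

lemma measurable_kendallKernel (α : ℝ) (ν : Measure ℝ) [SFinite ν] :
    Measurable (kendallKernel α ν) := by
  apply Measure.measurable_of_measurable_coe
  intro s hs
  have h : (fun x => kendallKernel α ν x s) = fun x => ∫⁻ y, kendallPoint α x y s ∂ν := by
    funext x
    exact Measure.bind_apply hs (measurable_kendallPoint_right α x).aemeasurable
  rw [h]
  exact Measurable.lintegral_prod_right'
    (f := fun p : ℝ × ℝ => kendallPoint α p.1 p.2 s)
    ((Measure.measurable_coe hs).comp (measurable_kendallPoint α))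

lemma kendallKernel_half (α : ℝ) (hα : 0 < α) (ν : Measure ℝ) [IsProbabilityMeasure ν]
    (h0 : ν {0} = 0) (x : ℝ) (s : Set ℝ)
    (hs : MeasurableSet s) (hinv : ∀ M : ℝ, 0 < M → (fun x => M * x) ⁻¹' s = s)
    (hp : pareto α s = 2⁻¹) (hd : deltaTilde 1 s = 2⁻¹) :
    kendallKernel α ν x s = 2⁻¹ := by
  unfold kendallKernel
  rw [Measure.bind_apply hs (measurable_kendallPoint_right α x).aemeasurable]
  have : ∀ᵐ y ∂ν, kendallPoint α x y s = 2⁻¹ := by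
    have h : ∀ᵐ y ∂ν, y ≠ 0 := by
      rw [ae_iff]; simpa using h0
    filter_upwards [h] with y hy
    exact kendallPoint_half α hα x y hy s hs hinv hp hd
  rw [lintegral_congr_ae this]
  simp

lemma excursion_half (α : ℝ) (hα : 0 < α) (ν : Measure ℝ) [IsProbabilityMeasure ν]
    (hsym : IsSymmetric ν) (h0 : ν {0} = 0) (k : ℕ) :
    excursion α ν k (Set.Ioi 0) = (1 / 2 : ENNReal) ^ (k + 1) ∧
    excursion α ν k (Set.Iic 0) = (1 / 2 : ENNReal) ^ (k + 1) := by
  induction k with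
  | zero =>
    have h1 : ν (Set.Ioi 0) = ν (Set.Iic 0) := by
      have e : ν (Set.Ioi 0) = ν (Set.Iio 0) := by
        conv_lhs => rw [← hsym]
        rw [Measure.map_apply (by fun_prop) measurableSet_Ioi]
        congr 1
        ext x; simp
      rw [e, ← Set.Iio_union_right, measure_union (by simp) (measurableSet_singleton 0), h0,
        add_zero]
    have h2 : ν (Set.Ioi 0) + ν (Set.Iic 0) = 1 := by
      rw [← Set.compl_Iic, add_comm]
      exact prob_add_prob_compl measurableSet_Iic
    have h3 : ν (Set.Ioi 0) = 1 / 2 := by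
      rw [← h1, ← two_mul] at h2
      rw [ENNReal.eq_div_iff (by simp) (by simp)]
      exact h2
    simp only [excursion, zero_add, pow_one]
    exact ⟨h3, h1 ▸ h3⟩
  | succ n ih =>
    have key : ∀ s : Set ℝ, MeasurableSet s → (∀ x, kendallKernel α ν x s = 2⁻¹) →
        excursion α ν (n + 1) s = (1 / 2 : ENNReal) ^ (n + 1 + 1) := by
      intro s hs h
      simp only [excursion]
      rw [Measure.bind_apply hs (measurable_kendallKernel α ν).aemeasurable]
      simp only [h, lintegral_const, Measure.restrict_apply_univ, ih.2]
      rw [pow_succ _ (n + 1), mul_comm]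
      simp
    exact ⟨key _ measurableSet_Ioi fun x => kendallKernel_half α hα ν h0 x _ measurableSet_Ioi
        inv_Ioi (pareto_Ioi α hα) deltaTilde_Ioi,
      key _ measurableSet_Iic fun x => kendallKernel_half α hα ν h0 x _ measurableSet_Iic
        inv_Iic (pareto_Iic α hα) deltaTilde_Iic⟩

/-- The first hitting time `τ₀⁺` of `(0,∞)` by the Kendall random walk started at `0` is
geometric with parameter `1/2`:
`P(τ₀⁺ = k + 1) = excursion α ν k ((0,∞)) = 2^{-(k+1)}` for every `k ≥ 0`. -/
theorem hitting_time_geometric (α : ℝ) (hα : 0 < α)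
    (ν : Measure ℝ) [IsProbabilityMeasure ν] (hsym : IsSymmetric ν) (h0 : ν {0} = 0)
    (k : ℕ) :
    (excursion α ν k) (Set.Ioi 0) = (1 / 2 : ENNReal) ^ (k + 1) := by
  exact (excursion_half α hα ν hsym h0 k).1
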